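/- Let m ≥ 3, n = (q^m−1)/(q−1) ≥ 6, and let t_1 and t_2 be any two distinct coordinate positions. Then the shortened code (H_{(q,m)}^⊥)_{{t_1,t_2}} of the Simplex code H_{(q,m)}^⊥ is an [n−2, m−2, q^{m−1}] code over GF(q) with weight enumerator 1 + (q^{m−2}−1) z^{q^{m−1}}; that is, all of its q^{m−2}−1 nonzero codewords have Hamming weight q^{m−1}. -/

import Mathlib

open Finset

section Defs

variable {F : Type} [Field F]

/-- The dual of a linear code `C ⊆ F^ι` w.r.t. the standard inner product. -/
def dualCode {ι : Type} [Fintype ι] (C : Submodule F (ι → F)) :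
    Submodule F (ι → F) where
  carrier := {x | ∀ c ∈ C, ∑ i, x i * c i = 0}
  add_mem' := by
    intro a b ha hb c hc
    simp only [Set.mem_setOf_eq] at ha hb ⊢
    simp only [Pi.add_apply, add_mul, Finset.sum_add_distrib, ha c hc, hb c hc, add_zero]
  zero_mem' := by
    intro c hc
    simp
  smul_mem' := by
    intro r a ha c hc
    simp only [Set.mem_setOf_eq] at ha ⊢
    simp only [Pi.smul_apply, smul_eq_mul, mul_assoc, ← Finset.mul_sum, ha c hc, mul_zero]

/-- The subcode of codewords vanishing on every coordinate in `T`. -/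
def zeroOn {ι : Type} (T : Finset ι) : Submodule F (ι → F) where
  carrier := {x | ∀ i ∈ T, x i = 0}
  add_mem' := by
    intro a b ha hb i hi
    simp only [Set.mem_setOf_eq] at ha hb
    simp [Pi.add_apply, ha i hi, hb i hi]
  zero_mem' := by intro i _; simp
  smul_mem' := by
    intro r a ha i hi
    simp only [Set.mem_setOf_eq] at ha
    simp [Pi.smul_apply, ha i hi]

/-- Deleting the coordinates in `T`. -/
def restrictTo {ι : Type} (T : Finset ι) : (ι → F) →ₗ[F] ({i : ι // i ∉ T} → F) :=
  LinearMap.funLeft F F Subtype.val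

/-- The punctured code `C^T`: delete the coordinates in `T` from every codeword. -/
def puncturedCode {ι : Type} (C : Submodule F (ι → F)) (T : Finset ι) :
    Submodule F ({i : ι // i ∉ T} → F) :=
  C.map (restrictTo T)

/-- The shortened code `C_T`: take the codewords vanishing on `T`, then delete `T`. -/
def shortenedCode {ι : Type} (C : Submodule F (ι → F)) (T : Finset ι) :
    Submodule F ({i : ι // i ∉ T} → F) :=
  (C ⊓ zeroOn T).map (restrictTo T)

/-- The code `C` has minimum distance (exactly) `d`. -/
def IsMinDist {ι : Type} [Fintype ι] [DecidableEq F] (C : Submodule F (ι → F)) (d : ℕ) : Prop :=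
  (∃ c ∈ C, c ≠ 0 ∧ hammingNorm c = d) ∧ ∀ c ∈ C, c ≠ 0 → d ≤ hammingNorm c

/-- `A_k(C)`: the number of codewords of Hamming weight `k` in `C`. -/
noncomputable def weightCount {ι : Type} [Fintype ι] [DecidableEq F]
    (C : Submodule F (ι → F)) (k : ℕ) : ℕ :=
  Nat.card {c : ι → F // c ∈ C ∧ hammingNorm c = k}

/-- A monomial transformation: permute the coordinates and scale each coordinate. -/
def monomialMap {ι κ : Type} (σ : ι ≃ κ) (u : κ → F) : (ι → F) →ₗ[F] (κ → F) where
  toFun x := fun j => u j * x (σ.symm j)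
  map_add' a b := by
    funext j
    simp [Pi.add_apply, mul_add]
  map_smul' r a := by
    funext j
    simp only [Pi.smul_apply, smul_eq_mul, RingHom.id_apply]
    ring

/-- Monomial equivalence of linear codes. -/
def MonomiallyEquiv {ι κ : Type} (C : Submodule F (ι → F)) (D : Submodule F (κ → F)) : Prop :=
  ∃ (σ : ι ≃ κ) (u : κ → F), (∀ j, u j ≠ 0) ∧ D = C.map (monomialMap σ u)

/-- The syndrome map attached to a parity-check matrix with columns `v i`. -/
def checkMap {m n : ℕ} (v : Fin n → (Fin m → F)) : (Fin n → F) →ₗ[F] (Fin m → F) where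
  toFun x := fun j => ∑ i, x i * v i j
  map_add' a b := by
    funext j
    simp [Pi.add_apply, add_mul, Finset.sum_add_distrib]
  map_smul' r a := by
    funext j
    simp [Pi.smul_apply, Finset.mul_sum, mul_assoc]

/-- `v` lists exactly one nonzero vector from each one-dimensional subspace of `F^m`. -/
def IsHammingMatrix {m n : ℕ} (v : Fin n → (Fin m → F)) : Prop :=
  (∀ i, v i ≠ 0) ∧ ∀ w : Fin m → F, w ≠ 0 → ∃! i : Fin n, ∃ c : F, w = c • v i

/-- The Hamming code attached to a parity-check matrix whose columns are the `v i`. -/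
def hammingCode {m n : ℕ} (v : Fin n → (Fin m → F)) : Submodule F (Fin n → F) :=
  LinearMap.ker (checkMap v)

/-- The Simplex code: the dual of the Hamming code. -/
def simplexCode {m n : ℕ} (v : Fin n → (Fin m → F)) : Submodule F (Fin n → F) :=
  dualCode (hammingCode v)

end Defs


section Aux

variable {F : Type} [Field F]

/-- Evaluation of functionals on the columns. -/
def evMap {m n : ℕ} (v : Fin n → (Fin m → F)) :
    Module.Dual F (Fin m → F) →ₗ[F] (Fin n → F) where
  toFun φ := fun i => φ (v i)
  map_add' a b := by funext j; simp
  map_smul' r a := by funext j; simp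

lemma checkMap_eq {m n : ℕ} (v : Fin n → (Fin m → F)) (x : Fin n → F) :
    checkMap v x = ∑ i, x i • v i := by
  funext j
  simp [checkMap, Finset.sum_apply]

lemma simplex_eq {m n : ℕ} (v : Fin n → (Fin m → F)) :
    simplexCode v = LinearMap.range (evMap v) := by
  ext x
  constructor
  · intro hx
    have hx' : ∀ c ∈ hammingCode v, ∑ i, x i * c i = 0 := hx
    let ψ : Module.Dual F (Fin n → F) := ∑ i, x i • LinearMap.proj i
    have hψ : ∀ c, ψ c = ∑ i, x i * c i := by
      intro c; simp [ψ, LinearMap.sum_apply]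
    have h : ψ ∈ (LinearMap.ker (checkMap v)).dualAnnihilator := by
      rw [Submodule.mem_dualAnnihilator]
      intro c hc
      rw [hψ]; exact hx' c hc
    rw [← LinearMap.range_dualMap_eq_dualAnnihilator_ker] at h
    obtain ⟨φ, hφ⟩ := h
    refine ⟨φ, ?_⟩
    funext i
    have h1 := LinearMap.congr_fun hφ (Pi.single i 1)
    rw [hψ, LinearMap.dualMap_apply, checkMap_eq] at h1
    simpa [Pi.single_apply, evMap] using h1
  · rintro ⟨φ, rfl⟩
    intro c hc
    have hc' : checkMap v c = 0 := hc
    rw [checkMap_eq] at hc'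
    have := congrArg φ hc'
    simpa [evMap, mul_comm] using this

lemma ev_weight [Fintype F] [DecidableEq F] {m n : ℕ} (hm : 1 ≤ m)
    (v : Fin n → (Fin m → F)) (hv : IsHammingMatrix v)
    (φ : Module.Dual F (Fin m → F)) (hφ : φ ≠ 0) :
    hammingNorm (evMap v φ) = Fintype.card F ^ (m - 1) := by
  classical
  have hker : Nat.card (LinearMap.ker φ) = Fintype.card F ^ (m - 1) := by
    rw [Module.natCard_eq_pow_finrank (K := F), Nat.card_eq_fintype_card]
    congr 1
    have h1 := LinearMap.finrank_range_add_finrank_ker φ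
    have h2 : LinearMap.range φ = ⊤ := LinearMap.range_eq_top.2 (LinearMap.surjective hφ)
    rw [h2] at h1
    simp at h1
    omega
  have hcompl : Nat.card {w : Fin m → F // φ w ≠ 0} = Fintype.card F ^ m - Fintype.card F ^ (m-1) := by
    have e : Nat.card {w : Fin m → F // φ w = 0} = Fintype.card F ^ (m - 1) := by
      rw [← hker]; exact Nat.card_congr (Equiv.subtypeEquivRight (by simp))
    rw [Nat.card_eq_fintype_card] at e ⊢
    rw [Fintype.card_subtype_compl, e]
    simp
  let g : {i : Fin n // φ (v i) ≠ 0} × Fˣ → {w : Fin m → F // φ w ≠ 0} :=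
    fun p => ⟨(p.2 : F) • v p.1, by simpa using p.1.2⟩
  have hg : Function.Bijective g := by
    constructor
    · rintro ⟨⟨i, hi⟩, a⟩ ⟨⟨j, hj⟩, b⟩ h
      have h' : (a : F) • v i = (b : F) • v j := congrArg Subtype.val h
      have hne : (a : F) • v i ≠ 0 := smul_ne_zero a.ne_zero (hv.1 i)
      have hij : i = j := (hv.2 _ hne).unique ⟨a, rfl⟩ ⟨b, h'⟩
      subst hij
      have hab : (a : F) = b := smul_left_injective F (hv.1 i) h'
      have : a = b := Units.ext hab
      rw [this]
    · rintro ⟨w, hw⟩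
      have hw0 : w ≠ 0 := by rintro rfl; simp at hw
      obtain ⟨i, ⟨c, hc⟩, -⟩ := hv.2 w hw0
      have hc0 : c ≠ 0 := by rintro rfl; simp at hc; exact hw0 hc
      refine ⟨⟨⟨i, ?_⟩, Units.mk0 c hc0⟩, Subtype.ext hc.symm⟩
      intro h
      apply hw
      rw [hc]; simp [h]
  have hcard := Nat.card_congr (Equiv.ofBijective g hg)
  rw [Nat.card_prod, hcompl] at hcard
  have hH : hammingNorm (evMap v φ) = Nat.card {i : Fin n // φ (v i) ≠ 0} := by
    rw [Nat.card_eq_fintype_card, Fintype.card_subtype]; rfl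
  rw [hH]
  have hu : Nat.card Fˣ = Fintype.card F - 1 := by
    rw [Nat.card_eq_fintype_card, Fintype.card_units]
  have hq1 : 1 < Fintype.card F := Fintype.one_lt_card
  rw [hu] at hcard
  have : Fintype.card F ^ m - Fintype.card F ^ (m-1)
      = Fintype.card F ^ (m-1) * (Fintype.card F - 1) := by
    obtain ⟨k, rfl⟩ : ∃ k, m = k + 1 := ⟨m - 1, by omega⟩
    simp [pow_succ, Nat.mul_sub]
  rw [this] at hcard
  exact Nat.eq_of_mul_eq_mul_right (by omega) hcard

lemma hamming_restrict [DecidableEq F] {n : ℕ} (T : Finset (Fin n)) (x : Fin n → F)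
    (hx : x ∈ zeroOn (F := F) T) : hammingNorm (restrictTo T x) = hammingNorm x := by
  classical
  have hx' : ∀ i ∈ T, x i = 0 := hx
  unfold hammingNorm
  apply Finset.card_bij (fun i _ => i.1)
  · intro a ha
    exact Finset.mem_filter.2 ⟨Finset.mem_univ _, (Finset.mem_filter.1 ha).2⟩
  · intro a _ b _ h
    exact Subtype.ext h
  · intro b hb
    have hb' : x b ≠ 0 := by simpa using hb
    refine ⟨⟨b, fun h => hb' (hx' b h)⟩, ?_, rfl⟩
    exact Finset.mem_filter.2 ⟨Finset.mem_univ _, hb'⟩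

end Aux

theorem statement9 {F : Type} [Field F] [Fintype F] [DecidableEq F] {m n : ℕ}
    (hm : 3 ≤ m) (hq : n * (Fintype.card F - 1) = Fintype.card F ^ m - 1) (hn : 6 ≤ n)
    (v : Fin n → (Fin m → F)) (hv : IsHammingMatrix v) (t1 t2 : Fin n) (h12 : t1 ≠ t2) :
    Nat.card {i : Fin n // i ∉ ({t1, t2} : Finset (Fin n))} = n - 2 ∧
    Module.finrank F ↥(shortenedCode (simplexCode v) {t1, t2}) = m - 2 ∧
    IsMinDist (shortenedCode (simplexCode v) {t1, t2}) (Fintype.card F ^ (m - 1)) ∧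
    (∀ c ∈ shortenedCode (simplexCode v) {t1, t2}, c ≠ 0 →
      hammingNorm c = Fintype.card F ^ (m - 1)) ∧
    weightCount (shortenedCode (simplexCode v) {t1, t2}) (Fintype.card F ^ (m - 1))
      = Fintype.card F ^ (m - 2) - 1 := by
  classical
  let T : Finset (Fin n) := {t1, t2}
  let W : Submodule F (Fin m → F) := Submodule.span F (Set.range ![v t1, v t2])
  have hT : (({t1, t2} : Finset (Fin n))) = T := rfl
  have hLI : LinearIndependent F ![v t1, v t2] := by
    rw [LinearIndependent.pair_iff' (hv.1 t1)]
    intro a ha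
    exact h12 ((hv.2 _ (hv.1 t2)).unique ⟨a, ha.symm⟩ ⟨1, (one_smul _ _).symm⟩)
  have hW : Module.finrank F W = 2 := by
    simpa using finrank_span_eq_card hLI
  have hK : Module.finrank F W.dualAnnihilator = m - 2 := by
    have := Subspace.finrank_add_finrank_dualAnnihilator_eq W
    simp at this
    omega
  have hKmem : ∀ φ : Module.Dual F (Fin m → F),
      φ ∈ W.dualAnnihilator ↔ evMap v φ ∈ zeroOn (F := F) T := by
    intro φ
    have e : evMap v φ ∈ zeroOn (F := F) T ↔ ∀ i ∈ T, φ (v i) = 0 := Iff.rfl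
    rw [e, Submodule.mem_dualAnnihilator]
    constructor
    · intro h i hi
      apply h
      apply Submodule.subset_span
      have : i = t1 ∨ i = t2 := by simpa [T] using hi
      rcases this with rfl | rfl
      · exact ⟨0, rfl⟩
      · exact ⟨1, rfl⟩
    · intro h w hw
      have hle : W ≤ LinearMap.ker φ := by
        apply Submodule.span_le.2
        rintro _ ⟨i, rfl⟩
        fin_cases i
        · exact h t1 (by simp [T])
        · exact h t2 (by simp [T])
      exact hle hw
  let f : Module.Dual F (Fin m → F) →ₗ[F] ({i : Fin n // i ∉ T} → F) :=
    (restrictTo T) ∘ₗ (evMap v)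
  have hC : shortenedCode (simplexCode v) T = W.dualAnnihilator.map f := by
    ext x
    constructor
    · rintro ⟨y, ⟨hy1, hy2⟩, rfl⟩
      rw [simplex_eq] at hy1
      obtain ⟨φ, rfl⟩ := hy1
      exact ⟨φ, (hKmem φ).2 hy2, rfl⟩
    · rintro ⟨φ, hφ, rfl⟩
      refine ⟨evMap v φ, ⟨?_, (hKmem φ).1 hφ⟩, rfl⟩
      rw [simplex_eq]
      exact ⟨φ, rfl⟩
  have hwt : ∀ φ ∈ W.dualAnnihilator, φ ≠ 0 →
      hammingNorm (f φ) = Fintype.card F ^ (m - 1) := by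
    intro φ hφ h0
    rw [← ev_weight (by omega) v hv φ h0]
    exact hamming_restrict T _ ((hKmem φ).1 hφ)
  have hqpos : 0 < Fintype.card F ^ (m - 1) := pow_pos Fintype.card_pos _
  have hfin : Module.finrank F (shortenedCode (simplexCode v) T) = m - 2 := by
    rw [hC, ← hK]
    have hinj : Function.Injective (f.domRestrict W.dualAnnihilator) := by
      refine (injective_iff_map_eq_zero _).2 ?_
      rintro ⟨φ, hφ⟩ h
      by_contra hne
      have h0 : φ ≠ 0 := fun h => hne (Subtype.ext h)
      have h1 := hwt φ hφ h0
      have h2 : f φ = 0 := h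
      rw [h2, hammingNorm_zero] at h1
      omega
    have := LinearMap.finrank_range_of_inj hinj
    rwa [LinearMap.range_domRestrict] at this
  have hall : ∀ c ∈ shortenedCode (simplexCode v) T, c ≠ 0 →
      hammingNorm c = Fintype.card F ^ (m - 1) := by
    intro c hc h0
    rw [hC] at hc
    obtain ⟨φ, hφ, rfl⟩ := hc
    exact hwt φ hφ (by rintro rfl; simp at h0)
  rw [hT]
  refine ⟨?_, hfin, ⟨?_, fun c hc h0 => (hall c hc h0).ge⟩, hall, ?_⟩
  · rw [Nat.card_eq_fintype_card, Fintype.card_subtype_compl, Fintype.card_coe, Fintype.card_fin,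
      Finset.card_pair h12]
  · have hne : shortenedCode (simplexCode v) T ≠ ⊥ := by
      intro h
      rw [h, finrank_bot] at hfin
      omega
    obtain ⟨c, hc, h0⟩ := Submodule.exists_mem_ne_zero_of_ne_bot hne
    exact ⟨c, hc, h0, hall c hc h0⟩
  · have hcardC : Nat.card (shortenedCode (simplexCode v) T) = Fintype.card F ^ (m - 2) := by
      rw [Module.natCard_eq_pow_finrank (K := F), Nat.card_eq_fintype_card, hfin]
    unfold weightCount
    rw [← hcardC]
    have e : {c : {i : Fin n // i ∉ T} → F // c ∈ shortenedCode (simplexCode v) T ∧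
        hammingNorm c = Fintype.card F ^ (m - 1)} ≃
        {c : shortenedCode (simplexCode v) T // c ≠ 0} :=
      { toFun := fun c => ⟨⟨c.1, c.2.1⟩, by
          intro h
          have h1 : c.1 = 0 := congrArg Subtype.val h
          have h2 := c.2.2
          rw [h1, hammingNorm_zero] at h2
          omega⟩
        invFun := fun c => ⟨c.1.1, c.1.2, hall _ c.1.2 (fun h => c.2 (Subtype.ext h))⟩
        left_inv := fun c => rfl
        right_inv := fun c => rfl }
    rw [Nat.card_congr e, Nat.card_eq_fintype_card, Nat.card_eq_fintype_card,
      Fintype.card_subtype_compl]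
    simp
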